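/- Let (X,d,m) be a metric measure space, x0 ∈ X, C > 0 and k ∈ ℕ. Assume that for every λ > 0 the integral ∫_X exp(−2λ d(x0,x)²) dm(x) is finite, and that for every Lipschitz function u : X → ℝ with bounded support, (∫_X d(x0,x)^{2k} (lip u(x))² dm)(∫_X d(x0,x)^{2k+2} u(x)² dm) ≥ (C+k)² (∫_X d(x0,x)^{2k} u(x)² dm)². Then for every λ > 0, 2λ ∫_X d(x0,x)^{2k+2} exp(−2λ d(x0,x)²) dm(x) ≥ (C+k) ∫_X d(x0,x)^{2k} exp(−2λ d(x0,x)²) dm(x). -/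

import Mathlib

open MeasureTheory Filter Metric
open scoped ENNReal Topology NNReal

/-- The local Lipschitz constant `lip u (x) = limsup_{y → x} |u y - u x| / d(y,x)`. -/
noncomputable def lip {X : Type*} [MetricSpace X] (u : X → ℝ) (x : X) : ℝ :=
  Filter.limsup (fun y => |u y - u x| / dist y x) (𝓝[≠] x)

theorem lip_nonneg {X : Type*} [MetricSpace X] (u : X → ℝ) (x : X) : 0 ≤ lip u x := by
  rw [lip, limsup_eq]
  rcases eq_or_neBot (𝓝[≠] x) with h | h
  · simp [h]
  · refine Real.sInf_nonneg fun a ha => ?_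
    obtain ⟨y, hy⟩ := Eventually.exists (Set.mem_ofPred_eq ▸ ha)
    exact le_trans (by positivity) hy

theorem lip_le_of_forall_eventually {X : Type*} [MetricSpace X] {u : X → ℝ} {x : X} {a : ℝ}
    (ha : 0 ≤ a)
    (h : ∀ ε > 0, ∀ᶠ y in 𝓝 x, |u y - u x| ≤ (a + ε) * dist y x) : lip u x ≤ a := by
  rw [lip, limsup_eq]
  rcases eq_or_neBot (𝓝[≠] x) with hx | hx
  · simpa [hx] using ha
  · refine le_of_forall_pos_le_add fun ε hε => csInf_le ⟨0, fun b hb => ?_⟩ ?_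
    · obtain ⟨y, hy⟩ := Eventually.exists (Set.mem_ofPred_eq ▸ hb)
      exact le_trans (by positivity) hy
    · have : ∀ᶠ y in 𝓝[≠] x, |u y - u x| / dist y x ≤ a + ε := by
        filter_upwards [nhdsWithin_le_nhds (h ε hε), self_mem_nhdsWithin] with y hy hne
        exact (div_le_iff₀ (dist_pos.2 hne)).2 hy
      exact this

theorem hasDerivAt_gaussian (lam t : ℝ) :
    HasDerivAt (fun t : ℝ => Real.exp (-lam * t ^ 2))
      (-(2 * lam * t * Real.exp (-lam * t ^ 2))) t := by
  have h := (((hasDerivAt_pow 2 t).const_mul (-lam)).exp)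
  convert h using 1
  push_cast
  ring

theorem lipschitzWith_gaussian {lam : ℝ} (hl : 0 < lam) :
    LipschitzWith (lam + 1).toNNReal (fun t : ℝ => Real.exp (-lam * t ^ 2)) := by
  refine lipschitzWith_of_nnnorm_deriv_le
    (fun t => (hasDerivAt_gaussian lam t).differentiableAt) fun t => ?_
  rw [(hasDerivAt_gaussian lam t).deriv, ← NNReal.coe_le_coe, coe_nnnorm,
    Real.coe_toNNReal _ (by positivity), norm_neg, Real.norm_eq_abs, abs_mul,
    abs_of_pos (Real.exp_pos _), neg_mul, Real.exp_neg, ← div_eq_mul_inv,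
    div_le_iff₀ (Real.exp_pos _), abs_mul, abs_of_pos (by positivity : 0 < 2 * lam)]
  calc 2 * lam * |t| ≤ (lam + 1) * (lam * t ^ 2 + 1) := by
        nlinarith [mul_nonneg hl.le (sq_nonneg (|t| - 1)), sq_abs t,
          mul_nonneg (sq_nonneg lam) (sq_nonneg t)]
    _ ≤ _ := by gcongr; exact Real.add_one_le_exp _

/-- The Gaussian `exp (-lam * d(x0, ·)²)` lowered by its value at distance `R` and cut off at `0`. -/
noncomputable def truncGaussian {X : Type*} [MetricSpace X] (x0 : X) (lam R : ℝ) (x : X) : ℝ :=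
  max (Real.exp (-lam * dist x0 x ^ 2) - Real.exp (-lam * R ^ 2)) 0

section truncGaussian

variable {X : Type*} [MetricSpace X] (x0 : X) {lam : ℝ}

theorem truncGaussian_nonneg (lam R : ℝ) (x : X) : 0 ≤ truncGaussian x0 lam R x :=
  le_max_right _ _

theorem truncGaussian_le (lam R : ℝ) (x : X) :
    truncGaussian x0 lam R x ≤ Real.exp (-lam * dist x0 x ^ 2) :=
  max_le (sub_le_self _ (Real.exp_pos _).le) (Real.exp_pos _).le

theorem sq_truncGaussian_le (lam R : ℝ) (x : X) :
    truncGaussian x0 lam R x ^ 2 ≤ Real.exp (-2 * lam * dist x0 x ^ 2) := by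
  calc truncGaussian x0 lam R x ^ 2 ≤ Real.exp (-lam * dist x0 x ^ 2) ^ 2 :=
        pow_le_pow_left₀ (truncGaussian_nonneg x0 lam R x) (truncGaussian_le x0 lam R x) 2
    _ = _ := by rw [← Real.exp_nat_mul]; congr 1; push_cast; ring

theorem lipschitzWith_truncGaussian (hl : 0 < lam) (R : ℝ) :
    LipschitzWith (lam + 1).toNNReal (truncGaussian x0 lam R) := by
  have h := (lipschitzWith_gaussian hl).comp (LipschitzWith.dist_right x0)
  rw [mul_one] at h
  have h' := h.sub (LipschitzWith.const (Real.exp (-lam * R ^ 2)))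
  rw [add_zero] at h'
  exact h'.max_const 0

theorem isBounded_support_truncGaussian (hl : 0 < lam) {R : ℝ} (hR : 0 ≤ R) :
    Bornology.IsBounded (Function.support (truncGaussian x0 lam R)) := by
  refine isBounded_closedBall (x := x0) (r := R) |>.subset fun x hx => ?_
  rw [mem_closedBall, dist_comm]
  by_contra! hlt
  refine hx (max_eq_right (sub_nonpos.2 (Real.exp_le_exp.2 ?_)))
  have : R ^ 2 ≤ dist x0 x ^ 2 := by gcongr
  nlinarith

theorem lip_truncGaussian_le (hl : 0 < lam) (R : ℝ) (x : X) :
    lip (truncGaussian x0 lam R) x ≤ 2 * lam * dist x0 x * Real.exp (-lam * dist x0 x ^ 2) := by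
  refine lip_le_of_forall_eventually (by positivity) fun ε hε => ?_
  have h1 := (hasDerivAt_gaussian lam (dist x0 x)).isLittleO.def hε
  have h2 : Tendsto (fun y => dist x0 y) (𝓝 x) (𝓝 (dist x0 x)) :=
    (continuous_const.dist continuous_id).tendsto x
  filter_upwards [h2.eventually h1] with y hy
  set a := 2 * lam * dist x0 x * Real.exp (-lam * dist x0 x ^ 2) with ha
  have ha0 : 0 ≤ a := by positivity
  have hd : |dist x0 y - dist x0 x| ≤ dist y x := by
    rw [dist_comm x0 y, dist_comm x0 x]
    exact abs_dist_sub_le y x x0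
  calc |truncGaussian x0 lam R y - truncGaussian x0 lam R x|
      ≤ |Real.exp (-lam * dist x0 y ^ 2) - Real.exp (-lam * dist x0 x ^ 2)| := by
        refine (abs_max_sub_max_le_abs _ _ _).trans_eq ?_
        rw [sub_sub_sub_cancel_right]
    _ ≤ (a + ε) * |dist x0 y - dist x0 x| := by
        simp only [Real.norm_eq_abs, smul_eq_mul] at hy
        have h3 := abs_sub_abs_le_abs_sub
          (Real.exp (-lam * dist x0 y ^ 2) - Real.exp (-lam * dist x0 x ^ 2))
          ((dist x0 y - dist x0 x) * -a)
        rw [abs_mul, abs_neg, abs_of_nonneg ha0] at h3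
        linarith
    _ ≤ _ := by gcongr

theorem tendsto_truncGaussian (hl : 0 < lam) (x : X) :
    Tendsto (fun n : ℕ => truncGaussian x0 lam n x) atTop
      (𝓝 (Real.exp (-lam * dist x0 x ^ 2))) := by
  have h1 : Tendsto (fun n : ℕ => Real.exp (-lam * (n : ℝ) ^ 2)) atTop (𝓝 0) := by
    refine Real.tendsto_exp_atBot.comp ?_
    exact ((tendsto_pow_atTop two_ne_zero).comp tendsto_natCast_atTop_atTop).const_mul_atTop_of_neg
      (neg_lt_zero.2 hl)
  have h2 := (h1.const_sub (Real.exp (-lam * dist x0 x ^ 2))).max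
    (tendsto_const_nhds (x := (0 : ℝ)))
  rwa [sub_zero, max_eq_left (Real.exp_pos _).le] at h2

end truncGaussian

theorem integrable_dist_pow_mul_gaussian {X : Type*} [MetricSpace X] [MeasurableSpace X]
    [BorelSpace X] {m : Measure X} {x0 : X}
    (hint : ∀ lam : ℝ, 0 < lam →
      (∫⁻ x, ENNReal.ofReal (Real.exp (-2 * lam * dist x0 x ^ 2)) ∂m) < ⊤)
    {lam : ℝ} (hl : 0 < lam) (j : ℕ) :
    Integrable (fun x => dist x0 x ^ (2 * j) * Real.exp (-2 * lam * dist x0 x ^ 2)) m := by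
  have hc : Continuous fun x : X => dist x0 x := continuous_const.dist continuous_id
  have hg : Integrable (fun x => Real.exp (-2 * (lam / 2) * dist x0 x ^ 2)) m := by
    refine ⟨(by fun_prop : Measurable _).aestronglyMeasurable, ?_⟩
    rw [hasFiniteIntegral_iff_ofReal (ae_of_all _ fun x => (Real.exp_pos _).le)]
    exact hint _ (half_pos hl)
  refine (hg.const_mul (j.factorial / lam ^ j)).mono'
    (by fun_prop : Measurable _).aestronglyMeasurable (ae_of_all _ fun x => ?_)
  rw [Real.norm_eq_abs, abs_of_nonneg (by positivity)]
  have h := Real.pow_div_factorial_le_exp (lam * dist x0 x ^ 2) (by positivity) j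
  rw [mul_pow, ← pow_mul, div_le_iff₀ (by positivity)] at h
  have he : Real.exp (-2 * (lam / 2) * dist x0 x ^ 2)
      = Real.exp (lam * dist x0 x ^ 2) * Real.exp (-2 * lam * dist x0 x ^ 2) := by
    rw [← Real.exp_add]; congr 1; ring
  rw [he, ← mul_assoc]
  gcongr
  rw [div_mul_eq_mul_div, le_div_iff₀ (by positivity)]
  linarith

theorem stmt_6 {X : Type*} [MetricSpace X] [CompleteSpace X]
    [TopologicalSpace.SeparableSpace X] [MeasurableSpace X] [BorelSpace X]
    (m : Measure X)
    (hm : ∀ U : Set X, IsOpen U → U.Nonempty → Bornology.IsBounded U → 0 < m U ∧ m U < ⊤)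
    (x0 : X) (C : ℝ) (hC : 0 < C) (k : ℕ)
    (hint : ∀ lam : ℝ, 0 < lam →
      (∫⁻ x, ENNReal.ofReal (Real.exp (-2 * lam * dist x0 x ^ 2)) ∂m) < ⊤)
    (hCKN : ∀ u : X → ℝ, (∃ K : ℝ≥0, LipschitzWith K u) →
      Bornology.IsBounded (Function.support u) →
      (∫ x, dist x0 x ^ (2 * k) * (lip u x) ^ 2 ∂m) *
        (∫ x, dist x0 x ^ (2 * k + 2) * (u x) ^ 2 ∂m) ≥
      (C + k) ^ 2 * (∫ x, dist x0 x ^ (2 * k) * (u x) ^ 2 ∂m) ^ 2) :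
    ∀ lam : ℝ, 0 < lam →
      2 * lam * ∫ x, dist x0 x ^ (2 * k + 2) * Real.exp (-2 * lam * dist x0 x ^ 2) ∂m ≥
        (C + k) * ∫ x, dist x0 x ^ (2 * k) * Real.exp (-2 * lam * dist x0 x ^ 2) ∂m := by
  intro lam hl
  have hA := integrable_dist_pow_mul_gaussian hint hl (k + 1)
  have hB := integrable_dist_pow_mul_gaussian hint hl k
  rw [mul_add, mul_one] at hA
  set A := ∫ x, dist x0 x ^ (2 * k + 2) * Real.exp (-2 * lam * dist x0 x ^ 2) ∂m
  set B := ∫ x, dist x0 x ^ (2 * k) * Real.exp (-2 * lam * dist x0 x ^ 2) ∂m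
  have hA0 : 0 ≤ A := integral_nonneg fun x => by positivity
  have hexp (x : X) :
      Real.exp (-lam * dist x0 x ^ 2) ^ 2 = Real.exp (-2 * lam * dist x0 x ^ 2) := by
    rw [← Real.exp_nat_mul]; congr 1; push_cast; ring
  have hlim : Tendsto (fun n : ℕ => ∫ x, dist x0 x ^ (2 * k) * truncGaussian x0 lam n x ^ 2 ∂m)
      atTop (𝓝 B) := by
    refine tendsto_integral_of_dominated_convergence _ (fun n => ?_) hB
      (fun n => ae_of_all _ fun x => ?_) (ae_of_all _ fun x => ?_)
    · have hd : Continuous fun x : X => dist x0 x := continuous_const.dist continuous_id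
      exact ((hd.pow _).mul
        ((lipschitzWith_truncGaussian x0 hl n).continuous.pow 2)).aestronglyMeasurable
    · rw [Real.norm_eq_abs, abs_of_nonneg (by positivity)]
      gcongr
      exact sq_truncGaussian_le x0 lam n x
    · rw [← hexp]
      exact ((tendsto_truncGaussian x0 hl x).pow 2).const_mul _
  have hbound (n : ℕ) :
      (C + k) ^ 2 * (∫ x, dist x0 x ^ (2 * k) * truncGaussian x0 lam n x ^ 2 ∂m) ^ 2
        ≤ (2 * lam * A) ^ 2 := by
    have hgrad : ∫ x, dist x0 x ^ (2 * k) * lip (truncGaussian x0 lam n) x ^ 2 ∂m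
        ≤ (2 * lam) ^ 2 * A := by
      rw [← integral_const_mul]
      refine integral_mono_of_nonneg (ae_of_all _ fun x => by positivity) (hA.const_mul _)
        (ae_of_all _ fun x => ?_)
      calc dist x0 x ^ (2 * k) * lip (truncGaussian x0 lam n) x ^ 2
          ≤ dist x0 x ^ (2 * k)
              * (2 * lam * dist x0 x * Real.exp (-lam * dist x0 x ^ 2)) ^ 2 := by
            gcongr
            · exact lip_nonneg _ _
            · exact lip_truncGaussian_le x0 hl n x
        _ = _ := by rw [mul_pow, hexp]; ring
    have hmass : ∫ x, dist x0 x ^ (2 * k + 2) * truncGaussian x0 lam n x ^ 2 ∂m ≤ A :=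
      integral_mono_of_nonneg (ae_of_all _ fun x => by positivity) hA
        (ae_of_all _ fun x => by
          dsimp only
          gcongr
          exact sq_truncGaussian_le x0 lam n x)
    calc _ ≤ _ := hCKN _ ⟨_, lipschitzWith_truncGaussian x0 hl n⟩
          (isBounded_support_truncGaussian x0 hl n.cast_nonneg)
      _ ≤ (2 * lam) ^ 2 * A * A :=
          mul_le_mul hgrad hmass (integral_nonneg fun x => by positivity) (by positivity)
      _ = _ := by ring
  have hsq := le_of_tendsto' ((hlim.pow 2).const_mul ((C + k) ^ 2)) hbound
  rw [← mul_pow] at hsq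
  exact le_of_abs_le (abs_le_of_sq_le_sq hsq (by positivity))
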